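/- arXiv:1705.04910 — 2 statements merged into one kernel-verified Lean document; each statement's English description precedes it below -/
import Mathlib

section
/- Σ = ⋃_{n≥0} (𝒮ₙ ∪ 𝒮ₙ') = 𝒮 ∩ ℛ⁴; in particular, the orbit of Δ ∪ Δ' under the reflection group H∞ is exactly the set of unit vectors of ℝ⁴ all of whose coordinates lie in ℛ. -/
noncomputable section

/-- The golden ratio τ = (1+√5)/2. -/
def gr : ℝ := (1 + Real.sqrt 5) / 2

/-- The ring ℤ[τ] as a subset of ℝ. -/
def Ztau : Set ℝ := {x : ℝ | ∃ a b : ℤ, x = (a : ℝ) + (b : ℝ) * gr}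

/-- Congruence modulo 2ℤ[τ]. -/
def cong2 (x y : ℝ) : Prop := ∃ a b : ℤ, x - y = 2 * ((a : ℝ) + (b : ℝ) * gr)

/-- The vector (0, 1, τ', τ) (for t = τ; its conjugate for t = τ'). -/
def v4 (t : ℝ) : Fin 4 → ℝ := ![0, 1, 1 - t, t]

/-- Representatives of the four classes of 𝔽₄ = ℤ[τ]/2ℤ[τ]. -/
def Reps : Set ℝ := {0, 1, gr, 1 + gr}

/-- `y` reduces mod 2ℤ[τ]⁴ into the 𝔽₄-span A of (1,1,1,1) and (0,1,τ',τ). -/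
def inAmod (t : ℝ) (y : Fin 4 → ℝ) : Prop :=
  ∃ c ∈ Reps, ∃ d ∈ Reps, ∀ i, cong2 (y i) (c + d * v4 t i)

/-- `y` reduces mod 2ℤ[τ]⁴ into Ȧ, the images of even permutations of (0,1,τ',τ). -/
def inAdot (t : ℝ) (y : Fin 4 → ℝ) : Prop :=
  ∃ σ : Equiv.Perm (Fin 4), Equiv.Perm.sign σ = 1 ∧ ∀ i, cong2 (y i) (v4 t (σ i))

/-- The spherical sets 𝒮ₙ (t = τ) resp. 𝒮ₙ' (t = τ'). -/
def sphS (t : ℝ) : ℕ → Set (Fin 4 → ℝ)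
  | 0 => {x | ∃ i, (x i = 1 ∨ x i = -1) ∧ ∀ j, j ≠ i → x j = 0}
  | (n+1) => {x | (∑ i, x i ^ 2) = 1 ∧ (∀ i, 2 ^ (n+1) * x i ∈ Ztau) ∧
      inAmod t (fun i => 2 ^ (n+1) * x i) ∧ ∃ i, ¬ cong2 (2 ^ (n+1) * x i) 0}
/-- The H₄ root system with parameter t (t = τ gives Δ, t = 1-τ = τ' gives Δ'). -/
def DeltaSet (t : ℝ) : Set (Fin 4 → ℝ) :=
  {x | (∃ i, (x i = 1 ∨ x i = -1) ∧ ∀ j, j ≠ i → x j = 0)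
    ∨ (∀ i, x i = 1/2 ∨ x i = -1/2)
    ∨ (∃ σ : Equiv.Perm (Fin 4), Equiv.Perm.sign σ = 1 ∧
        ∃ ε : Fin 4 → ℝ, (∀ i, ε i = 1 ∨ ε i = -1) ∧
          ∀ i, x i = ε i * (![0, 1, 1 - t, t] (σ i)) / 2)}

/-- The matrix of the reflection `x ↦ x - 2(x·a)a` in the standard basis. -/
def reflMat (a : Fin 4 → ℝ) : Matrix (Fin 4) (Fin 4) ℝ :=
  Matrix.of fun i j => (if i = j then (1 : ℝ) else 0) - 2 * a i * a j

/-- The orthogonal group O(4,ℝ) as the matrix orthogonal group. -/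
abbrev OG4 := Matrix.orthogonalGroup (Fin 4) ℝ

/-- H∞, the subgroup of O(4,ℝ) generated by the reflections in the roots of Δ ∪ Δ'. -/
def HinfG : Subgroup OG4 :=
  Subgroup.closure {g : OG4 |
    ∃ a ∈ DeltaSet gr ∪ DeltaSet (1 - gr), (g : Matrix (Fin 4) (Fin 4) ℝ) = reflMat a}

/-- SO(4,ℝ) inside O(4,ℝ). -/
def SO4set : Set OG4 := {g | Matrix.det (g : Matrix (Fin 4) (Fin 4) ℝ) = 1}

/-- Σ, the orbit of Δ ∪ Δ' under H∞. -/
def SigmaSet : Set (Fin 4 → ℝ) :=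
  {x | ∃ g ∈ HinfG, ∃ a ∈ DeltaSet gr ∪ DeltaSet (1 - gr),
    x = Matrix.mulVec (g : Matrix (Fin 4) (Fin 4) ℝ) a}


/-- ℛ = ℤ[1/2, τ], the ring of dyadic golden numbers, as a subset of ℝ. -/
def Rgold : Set ℝ := {x : ℝ | ∃ (a b : ℤ) (n : ℕ), x = ((a : ℝ) + (b : ℝ) * gr) / 2 ^ n}

/-- The ring ℤ[τ] as an abstract quadratic extension of ℤ. -/
abbrev GoldenInt := QuadraticAlgebra ℤ 1 1

/-- The residue field 𝔽₄ = ℤ[τ]/2ℤ[τ]. -/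
abbrev GoldenResidue := QuadraticAlgebra (ZMod 2) 1 1

namespace GoldenInt

open QuadraticAlgebra

instance : Fintype GoldenResidue :=
  Fintype.ofEquiv (ZMod 2 × ZMod 2) (QuadraticAlgebra.equivProd 1 1).symm

theorem gr_mul_self : gr * gr = gr + 1 := by
  have h : Real.sqrt 5 * Real.sqrt 5 = 5 := Real.mul_self_sqrt (by norm_num)
  unfold gr
  linear_combination h / 4

theorem irrational_gr : Irrational gr := Real.goldenRatio_irrational

/-- The embedding ℤ[τ] → ℝ. -/
def toReal : GoldenInt →+* ℝ where
  toFun z := z.re + z.im * gr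
  map_zero' := by simp
  map_one' := by simp
  map_add' x y := by simp; ring
  map_mul' x y := by
    simp
    linear_combination (-(x.im : ℝ) * y.im) * gr_mul_self

theorem toReal_mk (a b : ℤ) : toReal ⟨a, b⟩ = a + b * gr := rfl

theorem toReal_omega : toReal ω = gr := by simp [toReal]

theorem toReal_injective : Function.Injective toReal := by
  refine (injective_iff_map_eq_zero toReal).2 fun z hz => ?_
  have h : (z.re : ℝ) + z.im * gr = 0 := hz
  have him : z.im = 0 := by
    by_contra hne
    have hne' : (z.im : ℝ) ≠ 0 := by exact_mod_cast hne
    refine irrational_gr ⟨-z.re / z.im, ?_⟩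
    push_cast
    field_simp
    linarith
  have hre : z.re = 0 := by
    rw [him] at h
    simpa using h
  ext <;> simp [him, hre]

/-- Reduction modulo 2. -/
def residue : GoldenInt →+* GoldenResidue where
  toFun z := ⟨z.re, z.im⟩
  map_zero' := by ext <;> simp
  map_one' := by ext <;> simp
  map_add' x y := by ext <;> simp
  map_mul' x y := by ext <;> simp

theorem residue_eq_zero_iff (z : GoldenInt) : residue z = 0 ↔ ∃ w, z = 2 * w := by
  constructor
  · intro h
    have hre : ((z.re : ℤ) : ZMod 2) = 0 := congrArg QuadraticAlgebra.re h
    have him : ((z.im : ℤ) : ZMod 2) = 0 := congrArg QuadraticAlgebra.im h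
    obtain ⟨a, ha⟩ := (ZMod.intCast_zmod_eq_zero_iff_dvd _ 2).1 hre
    obtain ⟨b, hb⟩ := (ZMod.intCast_zmod_eq_zero_iff_dvd _ 2).1 him
    refine ⟨⟨a, b⟩, ?_⟩
    ext <;> simp [ha, hb]
  · rintro ⟨w, rfl⟩
    have h2 : (2 : GoldenResidue) = 0 := by decide
    rw [map_mul, map_ofNat, h2, zero_mul]

theorem residue_eq_iff (x y : GoldenInt) : residue x = residue y ↔ ∃ w, x = y + 2 * w := by
  rw [← sub_eq_zero, ← map_sub, residue_eq_zero_iff]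
  simp only [sub_eq_iff_eq_add']

theorem cong2_toReal_iff (x y : GoldenInt) :
    cong2 (toReal x) (toReal y) ↔ residue x = residue y := by
  rw [residue_eq_iff]
  constructor
  · rintro ⟨a, b, h⟩
    refine ⟨⟨a, b⟩, toReal_injective ?_⟩
    rw [map_add, map_mul, map_ofNat, toReal_mk a b]
    linarith
  · rintro ⟨w, rfl⟩
    refine ⟨w.re, w.im, ?_⟩
    rw [map_add, map_mul, map_ofNat, ← toReal_mk]
    ring

/-- The vector (0, 1, 1 - s, s) over any ring. -/
def quad {R : Type*} [Ring R] (s : R) : Fin 4 → R := ![0, 1, 1 - s, s]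

theorem map_quad {R S : Type*} [Ring R] [Ring S] (f : R →+* S) (s : R) (i : Fin 4) :
    f (quad s i) = quad (f s) i := by
  fin_cases i <;> simp [quad]

theorem sum_quad {R : Type*} [CommRing R] (s : R) : ∑ i, quad s i = 2 := by
  simp [quad, Fin.sum_univ_four]
  ring

theorem sum_quad_mul_self {R : Type*} [CommRing R] {s : R} (hs : s * s = s + 1) :
    ∑ i, quad s i * quad s i = 4 := by
  simp [quad, Fin.sum_univ_four]
  linear_combination 2 * hs

theorem residue_exists_mul_quad : ∀ r : GoldenResidue, r * r = r + 1 →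
    ∀ c : GoldenResidue, c ≠ 0 → ∀ e : GoldenResidue, ∃ k, c * quad r k = e := by
  decide

theorem residue_exists_quad_mul_self : ∀ r : GoldenResidue, r * r = r + 1 →
    ∀ e : GoldenResidue, ∃ k, quad r k * quad r k = e := by
  decide

set_option maxRecDepth 100000 in
theorem residue_exists_perm : ∀ r : GoldenResidue, r * r = r + 1 →
    ∀ c d : GoldenResidue, d ≠ 0 →
      ∃ σ : Equiv.Perm (Fin 4), Equiv.Perm.sign σ = 1 ∧ ∀ i, c + d * quad r i = quad r (σ i) := by
  decide

set_option maxRecDepth 100000 in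
theorem residue_classify : ∀ a b c d : GoldenResidue, a + b + c + d = 0 →
    a * b + a * c + a * d + b * c + b * d + c * d = 0 →
      (c = a + (b - a) * (1 - ω) ∧ d = a + (b - a) * ω) ∨
      (c = a + (b - a) * ω ∧ d = a + (b - a) * (1 - ω)) := by
  decide

theorem isReduced_residue : ∀ r : GoldenResidue, r * r = 0 → r = 0 := by
  decide

theorem residue_two : (2 : GoldenResidue) = 0 := by
  decide

/-- Twice a root of the third kind in the root system with parameter `s`. -/
def IsDoubleRoot (s : GoldenInt) (b : Fin 4 → GoldenInt) : Prop :=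
  ∃ σ : Equiv.Perm (Fin 4), Equiv.Perm.sign σ = 1 ∧ ∃ ε : Fin 4 → GoldenInt,
    (∀ i, ε i = 1 ∨ ε i = -1) ∧ ∀ i, b i = ε i * quad s (σ i)

/-- `s` is one of the two roots τ, τ' of `x² = x + 1`. -/
def IsGolden (s : GoldenInt) : Prop := s = ω ∨ s = 1 - ω

theorem IsGolden.mul_self {s : GoldenInt} (hs : IsGolden s) : s * s = s + 1 := by
  rcases hs with rfl | rfl <;> decide

theorem IsGolden.residue_mul_self {s : GoldenInt} (hs : IsGolden s) :
    residue s * residue s = residue s + 1 := by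
  rw [← map_mul, hs.mul_self, map_add, map_one]

theorem IsGolden.toReal_eq {s : GoldenInt} (hs : IsGolden s) :
    toReal s = gr ∨ toReal s = 1 - gr := by
  rcases hs with rfl | rfl
  · exact Or.inl toReal_omega
  · exact Or.inr (by rw [map_sub, map_one, toReal_omega])

theorem IsDoubleRoot.sum_mul_self {s : GoldenInt} (hs : IsGolden s) {b : Fin 4 → GoldenInt}
    (hb : IsDoubleRoot s b) : ∑ i, b i * b i = 4 := by
  obtain ⟨σ, -, ε, hε, hb⟩ := hb
  rw [← sum_quad_mul_self hs.mul_self, ← Equiv.sum_comp σ fun i => quad s i * quad s i]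
  refine Finset.sum_congr rfl fun i _ => ?_
  rw [hb]
  rcases hε i with h | h <;> rw [h] <;> ring

/-- Flipping the sign of one coordinate of a double root changes half of its inner product with
`y` in a controlled way modulo 2. -/
theorem exists_doubleRoot_of_flip {s m : GoldenInt} {y : Fin 4 → GoldenInt}
    {σ : Equiv.Perm (Fin 4)} (hσ : Equiv.Perm.sign σ = 1)
    (hm : ∑ i, y i * quad s (σ i) = 2 * m) (j : Fin 4)
    (hj : residue (m - y j * quad s (σ j)) = 1) :
    ∃ b, IsDoubleRoot s b ∧ ∃ u, ∑ i, y i * b i = 2 * u ∧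
      ∀ i, residue (y i - u * b i) = residue (y i) - residue (quad s (σ i)) := by
  refine ⟨fun i => (if i = j then -1 else 1) * quad s (σ i),
    ⟨σ, hσ, fun i => if i = j then -1 else 1, fun i => by by_cases h : i = j <;> simp [h],
      fun i => rfl⟩, m - y j * quad s (σ j), ?_, fun i => ?_⟩
  · have h : ∀ i, y i * ((if i = j then -1 else 1) * quad s (σ i)) =
        y i * quad s (σ i) - if i = j then 2 * (y j * quad s (σ j)) else 0 := by
      intro i
      by_cases h : i = j
      · subst h
        simp only [if_true]
        ring
      · simp only [if_neg h]
        ring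
    simp only [h, Finset.sum_sub_distrib, hm, Finset.sum_ite_eq', Finset.mem_univ, if_true]
    ring
  · rw [map_sub, map_mul, hj, one_mul]
    by_cases h : i = j
    · simp only [h, if_true, neg_one_mul, map_neg]
      congr 1
      linear_combination -residue (quad s (σ j)) * residue_two
    · simp [h]

/-- A numerator in a class `c + d • quad s` with `d ≠ 0` becomes divisible by 2 under reflection
in a suitable root. -/
theorem exists_doubleRoot_reduction {s : GoldenInt} (hs : IsGolden s) {y : Fin 4 → GoldenInt}
    {c d : GoldenResidue} (hd : d ≠ 0) (hy : ∀ i, residue (y i) = c + d * quad (residue s) i) :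
    ∃ b, IsDoubleRoot s b ∧ ∃ u, ∑ i, y i * b i = 2 * u ∧
      ∀ i, residue (y i - u * b i) = 0 := by
  obtain ⟨σ, hσ, h⟩ := residue_exists_perm _ hs.residue_mul_self c d hd
  have hyσ : ∀ i, residue (y i) = residue (quad s (σ i)) := fun i => by rw [hy, h, map_quad]
  choose z hz using fun i => (residue_eq_iff _ _).1 (hyσ i)
  have hm : ∑ i, y i * quad s (σ i) = 2 * (2 + ∑ i, z i * quad s (σ i)) := by
    have h4 : ∑ i, quad s (σ i) * quad s (σ i) = 4 := by
      rw [← sum_quad_mul_self hs.mul_self]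
      exact Equiv.sum_comp σ fun i => quad s i * quad s i
    have hi : ∀ i, y i * quad s (σ i) =
        quad s (σ i) * quad s (σ i) + 2 * (z i * quad s (σ i)) := fun i => by
      conv_lhs => rw [hz i]
      ring
    rw [Finset.sum_congr rfl fun i _ => hi i, Finset.sum_add_distrib, h4, ← Finset.mul_sum]
    ring
  obtain ⟨k, hk⟩ := residue_exists_quad_mul_self _ hs.residue_mul_self
    (residue (2 + ∑ i, z i * quad s (σ i)) - 1)
  obtain ⟨b, hb, u, hu, hr⟩ := exists_doubleRoot_of_flip hσ hm (σ.symm k) (by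
    rw [map_sub, map_mul, hyσ, Equiv.apply_symm_apply, map_quad, hk]
    ring)
  exact ⟨b, hb, u, hu, fun i => by rw [hr, hyσ, sub_self]⟩

/-- A numerator in a nonzero class `c • (1, 1, 1, 1)` is moved by reflection in a suitable root
to a class which is not a multiple of `(1, 1, 1, 1)`. -/
theorem exists_doubleRoot_move {s : GoldenInt} (hs : IsGolden s) {y : Fin 4 → GoldenInt}
    {c : GoldenResidue} (hc : c ≠ 0) (hy : ∀ i, residue (y i) = c) :
    ∃ b, IsDoubleRoot s b ∧ ∃ u, ∑ i, y i * b i = 2 * u ∧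
      ∀ i, residue (y i - u * b i) = c + -1 * quad (residue s) i := by
  choose z hz using fun i => (residue_eq_iff (y i) (y 0)).1 (by rw [hy, hy])
  have hm : ∑ i, y i * quad s (Equiv.refl (Fin 4) i) = 2 * (y 0 + ∑ i, z i * quad s i) := by
    have hi : ∀ i, y i * quad s i = y 0 * quad s i + 2 * (z i * quad s i) := fun i => by
      conv_lhs => rw [hz i]
      ring
    simp only [Equiv.refl_apply]
    rw [Finset.sum_congr rfl fun i _ => hi i, Finset.sum_add_distrib, ← Finset.mul_sum,
      ← Finset.mul_sum, sum_quad]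
    ring
  obtain ⟨k, hk⟩ := residue_exists_mul_quad _ hs.residue_mul_self c hc
    (residue (y 0 + ∑ i, z i * quad s i) - 1)
  obtain ⟨b, hb, u, hu, hr⟩ := exists_doubleRoot_of_flip Equiv.Perm.sign_refl hm k (by
    rw [map_sub, map_mul, hy, Equiv.refl_apply, map_quad, hk]
    ring)
  refine ⟨b, hb, u, hu, fun i => ?_⟩
  rw [hr, hy, Equiv.refl_apply, map_quad]
  ring

/-- The numerator of a unit vector with denominator a positive power of 2 reduces to one of the
two isotropic planes. -/
theorem exists_residue_class {y : Fin 4 → GoldenInt} {n : ℕ} (h : ∑ i, y i * y i = 4 ^ (n + 1)) :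
    ∃ s, IsGolden s ∧ ∃ c d : GoldenResidue, ∀ i, residue (y i) = c + d * quad (residue s) i := by
  rw [Fin.sum_univ_four] at h
  have h1 : residue (y 0 + y 1 + y 2 + y 3) = 0 := by
    refine isReduced_residue _ ?_
    rw [← map_mul, residue_eq_zero_iff]
    refine ⟨2 * 4 ^ n + (y 0 * y 1 + y 0 * y 2 + y 0 * y 3 + y 1 * y 2 + y 1 * y 3 + y 2 * y 3), ?_⟩
    rw [pow_succ] at h
    linear_combination h
  have h2 : residue
      (y 0 * y 1 + y 0 * y 2 + y 0 * y 3 + y 1 * y 2 + y 1 * y 3 + y 2 * y 3) = 0 := by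
    obtain ⟨k, hk⟩ := (residue_eq_zero_iff _).1 h1
    rw [residue_eq_zero_iff]
    refine ⟨k * k - 4 ^ n, ?_⟩
    have inj : ∀ v w : GoldenInt, 2 * v = 2 * w → v = w := fun v w hvw => by
      ext
      · have := congrArg QuadraticAlgebra.re hvw
        simpa using this
      · have := congrArg QuadraticAlgebra.im hvw
        simpa using this
    apply inj
    rw [pow_succ] at h
    linear_combination (y 0 + y 1 + y 2 + y 3 + 2 * k) * hk - h
  simp only [map_add, map_mul] at h1 h2
  have hω : residue ω = ω := by decide
  rcases residue_classify _ _ _ _ h1 h2 with ⟨h3, h4⟩ | ⟨h3, h4⟩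
  · refine ⟨ω, Or.inl rfl, residue (y 0), residue (y 1) - residue (y 0), fun i => ?_⟩
    rw [hω]
    fin_cases i <;> simp [quad, h3, h4]
  · refine ⟨1 - ω, Or.inr rfl, residue (y 0), residue (y 1) - residue (y 0), fun i => ?_⟩
    rw [map_sub, map_one, hω]
    fin_cases i <;> simp [quad, h3, h4]

theorem exists_eq_one_of_sum_mul_self {y : Fin 4 → GoldenInt} (h : ∑ i, y i * y i = 1) :
    ∃ i, (y i = 1 ∨ y i = -1) ∧ ∀ j, j ≠ i → y j = 0 := by
  set q : GoldenInt → ℤ := fun z => z.re ^ 2 + (z.re + z.im) ^ 2 + 2 * z.im ^ 2 with hq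
  have q_nonneg : ∀ z, 0 ≤ q z := fun z => by positivity
  have q_zero : ∀ z, q z < 2 → z = 0 := by
    intro z hz
    simp only [hq] at hz
    have him : z.im = 0 := by
      by_contra hne
      have := Int.one_le_abs hne
      have h2 : 1 ≤ z.im ^ 2 := by
        rw [← sq_abs]
        nlinarith
      nlinarith [sq_nonneg z.re, sq_nonneg (z.re + z.im)]
    have hre : z.re = 0 := by
      by_contra hne
      have := Int.one_le_abs hne
      have h2 : 1 ≤ z.re ^ 2 := by
        rw [← sq_abs]
        nlinarith
      rw [him] at hz
      nlinarith
    ext <;> simp [him, hre]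
  have q_one : ∀ z, q z ≤ 2 → z = 0 ∨ z = 1 ∨ z = -1 := by
    intro z hz
    simp only [hq] at hz
    have him : z.im = 0 := by
      by_contra hne
      have h2 : 1 ≤ z.im ^ 2 := by
        rw [← sq_abs]
        nlinarith [Int.one_le_abs hne]
      have h3 : z.re ^ 2 = 0 := by nlinarith [sq_nonneg z.re, sq_nonneg (z.re + z.im)]
      have h4 : (z.re + z.im) ^ 2 = 0 := by nlinarith [sq_nonneg z.re, sq_nonneg (z.re + z.im)]
      rw [pow_eq_zero_iff two_ne_zero] at h3 h4
      omega
    rw [him] at hz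
    have h1 : z.re ≤ 1 := by nlinarith
    have h2 : -1 ≤ z.re := by nlinarith
    have h3 : z.re = 0 ∨ z.re = 1 ∨ z.re = -1 := by omega
    rcases h3 with h3 | h3 | h3
    · exact Or.inl (by ext <;> simp [him, h3])
    · exact Or.inr (Or.inl (by ext <;> simp [him, h3]))
    · exact Or.inr (Or.inr (by ext <;> simp [him, h3]))
  have hsum : ∑ i, q (y i) = 2 := by
    have hre := congrArg QuadraticAlgebra.re h
    have him := congrArg QuadraticAlgebra.im h
    simp only [Fin.sum_univ_four, re_add, re_mul, im_add, im_mul, re_one, im_one] at hre him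
    simp only [hq, Fin.sum_univ_four]
    linear_combination 2 * hre + him
  obtain ⟨i, hi⟩ : ∃ i, y i ≠ 0 := by
    by_contra! h0
    simp [h0] at h
  have hle : ∀ j, q (y j) ≤ 2 := fun j =>
    hsum ▸ Finset.single_le_sum (fun k _ => q_nonneg (y k)) (Finset.mem_univ j)
  have hi2 : 2 ≤ q (y i) := not_lt.1 fun hlt => hi (q_zero _ hlt)
  refine ⟨i, (q_one _ (hle i)).resolve_left hi, fun j hj => q_zero _ ?_⟩
  have hpair : q (y i) + q (y j) ≤ 2 := by
    rw [← hsum, ← Finset.sum_pair (f := fun k => q (y k)) hj.symm]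
    exact Finset.sum_le_sum_of_subset_of_nonneg (Finset.subset_univ _)
      fun k _ _ => q_nonneg (y k)
  linarith

end GoldenInt

open QuadraticAlgebra GoldenInt

/-- ℛ as a subring of ℝ. -/
def dyadicGolden : Subring ℝ where
  carrier := Rgold
  zero_mem' := ⟨0, 0, 0, by simp⟩
  one_mem' := ⟨1, 0, 0, by simp⟩
  add_mem' := by
    rintro _ _ ⟨a, b, m, rfl⟩ ⟨c, d, n, rfl⟩
    refine ⟨a * 2 ^ n + c * 2 ^ m, b * 2 ^ n + d * 2 ^ m, m + n, ?_⟩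
    push_cast
    field_simp
    ring
  neg_mem' := by
    rintro _ ⟨a, b, m, rfl⟩
    refine ⟨-a, -b, m, ?_⟩
    push_cast
    ring
  mul_mem' := by
    rintro _ _ ⟨a, b, m, rfl⟩ ⟨c, d, n, rfl⟩
    refine ⟨a * c + b * d, a * d + b * c + b * d, m + n, ?_⟩
    rw [div_mul_div_comm, pow_add]
    push_cast
    congr 1
    linear_combination (b * d : ℝ) * gr_mul_self

theorem mem_dyadicGolden_iff {x : ℝ} : x ∈ dyadicGolden ↔ x ∈ Rgold := Iff.rfl

theorem toReal_div_mem_dyadicGolden (z : GoldenInt) (n : ℕ) :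
    toReal z / 2 ^ n ∈ dyadicGolden :=
  ⟨z.re, z.im, n, rfl⟩

theorem gr_mem_dyadicGolden : gr ∈ dyadicGolden := ⟨0, 1, 0, by simp⟩

theorem half_mem_dyadicGolden : (2 : ℝ)⁻¹ ∈ dyadicGolden := ⟨1, 0, 1, by simp⟩

/-- The unit vectors with coordinates in ℛ. -/
def unitVectors : Set (Fin 4 → ℝ) := {x | (∑ i, x i ^ 2) = 1 ∧ ∀ i, x i ∈ Rgold}

/-- The vector with numerator `y` and denominator `2 ^ n`. -/
def scaledVec (n : ℕ) (y : Fin 4 → GoldenInt) : Fin 4 → ℝ := fun i => toReal (y i) / 2 ^ n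

theorem sum_sq_scaledVec (n : ℕ) (y : Fin 4 → GoldenInt) :
    ∑ i, scaledVec n y i ^ 2 = 1 ↔ ∑ i, y i * y i = 4 ^ n := by
  have h4 : (4 : ℝ) ^ n = (2 ^ n) ^ 2 := by
    rw [← pow_mul, mul_comm, pow_mul]
    norm_num
  have h : ∑ i, scaledVec n y i ^ 2 = toReal (∑ i, y i * y i) / 4 ^ n := by
    rw [h4, map_sum, Finset.sum_div]
    exact Finset.sum_congr rfl fun i _ => by rw [scaledVec, div_pow, map_mul, sq (toReal (y i))]
  rw [h, div_eq_one_iff_eq (by positivity), ← toReal_injective.eq_iff, map_pow, map_ofNat]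

theorem scaledVec_succ_two_mul (n : ℕ) (y : Fin 4 → GoldenInt) :
    scaledVec (n + 1) (fun i => 2 * y i) = scaledVec n y := by
  funext i
  simp only [scaledVec, map_mul, map_ofNat, pow_succ]
  field_simp

theorem exists_scaledVec {x : Fin 4 → ℝ} (hx : ∀ i, x i ∈ Rgold) :
    ∃ n y, x = scaledVec n y := by
  choose a b m h using hx
  refine ⟨∑ i, m i, fun i => ⟨a i, b i⟩ * 2 ^ (∑ k ∈ Finset.univ.erase i, m k), ?_⟩
  funext i
  rw [h, scaledVec, ← Finset.add_sum_erase _ m (Finset.mem_univ i), map_mul, map_pow, map_ofNat,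
    toReal_mk, pow_add, mul_div_mul_right _ _ (by positivity)]

theorem sum_sq_of_coordinate {x : Fin 4 → ℝ}
    (h : ∃ i, (x i = 1 ∨ x i = -1) ∧ ∀ j, j ≠ i → x j = 0) : ∑ i, x i ^ 2 = 1 := by
  obtain ⟨i, hi, h0⟩ := h
  rw [Finset.sum_eq_single i (fun j _ hj => by rw [h0 j hj]; norm_num) (by simp)]
  rcases hi with hi | hi <;> rw [hi] <;> norm_num

theorem mem_dyadicGolden_of_coordinate {x : Fin 4 → ℝ}
    (h : ∃ i, (x i = 1 ∨ x i = -1) ∧ ∀ j, j ≠ i → x j = 0) (j : Fin 4) :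
    x j ∈ dyadicGolden := by
  obtain ⟨i, hi, h0⟩ := h
  by_cases hj : j = i
  · subst hj
    rcases hi with hi | hi <;> rw [hi]
    · exact one_mem _
    · exact neg_mem (one_mem _)
  · rw [h0 j hj]
    exact zero_mem _

theorem deltaSet_subset_unitVectors {t : ℝ} (ht : t * t = t + 1) (htR : t ∈ dyadicGolden) :
    DeltaSet t ⊆ unitVectors := by
  rintro x (h | h | ⟨σ, -, ε, hε, h⟩)
  · exact ⟨sum_sq_of_coordinate h, mem_dyadicGolden_of_coordinate h⟩
  · have hsq : ∀ i, x i ^ 2 = 1 / 4 := fun i => by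
      rcases h i with h | h <;> rw [h] <;> norm_num
    refine ⟨by simp [hsq], fun i => ?_⟩
    rcases h i with h | h <;> rw [h]
    · exact ⟨1, 0, 1, by simp⟩
    · exact ⟨-1, 0, 1, by simp⟩
  · have hx : ∀ i, x i = ε i * quad t (σ i) / 2 := h
    have hsq : ∀ i, x i ^ 2 = quad t (σ i) * quad t (σ i) / 4 := fun i => by
      rw [hx]
      rcases hε i with h | h <;> rw [h] <;> ring
    have hq : ∀ k, quad t k ∈ dyadicGolden := fun k => by
      fin_cases k
      · exact zero_mem _
      · exact one_mem _
      · exact sub_mem (one_mem _) htR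
      · exact htR
    refine ⟨?_, fun i => ?_⟩
    · simp only [hsq, ← Finset.sum_div]
      rw [Equiv.sum_comp σ fun i => quad t i * quad t i, sum_quad_mul_self ht]
      norm_num
    · rw [hx, div_eq_mul_inv, ← mem_dyadicGolden_iff]
      refine mul_mem (mul_mem ?_ (hq _)) half_mem_dyadicGolden
      rcases hε i with h | h <;> rw [h]
      · exact one_mem _
      · exact neg_mem (one_mem _)

theorem roots_subset_unitVectors : DeltaSet gr ∪ DeltaSet (1 - gr) ⊆ unitVectors :=
  Set.union_subset (deltaSet_subset_unitVectors gr_mul_self gr_mem_dyadicGolden)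
    (deltaSet_subset_unitVectors (by linear_combination gr_mul_self)
      (sub_mem (one_mem _) gr_mem_dyadicGolden))

theorem reflMat_mulVec (a x : Fin 4 → ℝ) (i : Fin 4) :
    (reflMat a).mulVec x i = x i - 2 * (∑ j, x j * a j) * a i := by
  simp only [Matrix.mulVec, dotProduct, reflMat, Matrix.of_apply, sub_mul, ite_mul, one_mul,
    zero_mul, Finset.sum_sub_distrib, Finset.sum_ite_eq, Finset.mem_univ, if_true,
    Finset.mul_sum, Finset.sum_mul]
  congr 1
  exact Finset.sum_congr rfl fun j _ => by ring

theorem reflMat_transpose (a : Fin 4 → ℝ) : (reflMat a).transpose = reflMat a := by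
  ext i j
  simp only [reflMat, Matrix.transpose_apply, Matrix.of_apply, eq_comm (a := i)]
  ring

theorem reflMat_mul_self {a : Fin 4 → ℝ} (ha : ∑ i, a i ^ 2 = 1) :
    reflMat a * reflMat a = 1 := by
  refine Matrix.ext_of_mulVec_single fun k => funext fun i => ?_
  generalize (Pi.single k 1 : Fin 4 → ℝ) = x
  rw [← Matrix.mulVec_mulVec, reflMat_mulVec, Matrix.one_mulVec]
  simp only [reflMat_mulVec, sub_mul, Finset.sum_sub_distrib]
  have h : ∑ j, 2 * (∑ l, x l * a l) * a j * a j = 2 * (∑ l, x l * a l) := by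
    simp only [mul_assoc _ (a _) (a _), ← sq]
    rw [← Finset.mul_sum, ha, mul_one]
  rw [h]
  ring

theorem reflMat_mem_orthogonalGroup {a : Fin 4 → ℝ} (ha : ∑ i, a i ^ 2 = 1) :
    reflMat a ∈ Matrix.orthogonalGroup (Fin 4) ℝ := by
  rw [Matrix.mem_orthogonalGroup_iff, reflMat_transpose, reflMat_mul_self ha]

theorem root_mem_sigmaSet {a : Fin 4 → ℝ} (ha : a ∈ DeltaSet gr ∪ DeltaSet (1 - gr)) :
    a ∈ SigmaSet :=
  ⟨1, one_mem _, a, ha, by simp⟩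

theorem mem_sigmaSet_of_reflMat {a x : Fin 4 → ℝ} (ha : a ∈ DeltaSet gr ∪ DeltaSet (1 - gr))
    (hx : (reflMat a).mulVec x ∈ SigmaSet) : x ∈ SigmaSet := by
  obtain ⟨g, hg, b, hb, h⟩ := hx
  have ha1 := (roots_subset_unitVectors ha).1
  let r : OG4 := ⟨reflMat a, reflMat_mem_orthogonalGroup ha1⟩
  refine ⟨r * g, mul_mem (Subgroup.subset_closure ⟨a, ha, rfl⟩) hg, b, hb, ?_⟩
  have hr : ((r * g : OG4) : Matrix (Fin 4) (Fin 4) ℝ) = reflMat a * g := rfl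
  rw [hr, ← Matrix.mulVec_mulVec, ← h, Matrix.mulVec_mulVec, reflMat_mul_self ha1,
    Matrix.one_mulVec]

theorem entries_mem_of_mem_HinfG {g : OG4} (hg : g ∈ HinfG) :
    ∀ i j, (g : Matrix (Fin 4) (Fin 4) ℝ) i j ∈ dyadicGolden := by
  induction hg using Subgroup.closure_induction with
  | mem g hg =>
    obtain ⟨a, ha, hga⟩ := hg
    have haR : ∀ i, a i ∈ dyadicGolden := (roots_subset_unitVectors ha).2
    intro i j
    rw [hga]
    simp only [reflMat, Matrix.of_apply]
    refine sub_mem ?_ (mul_mem (mul_mem (ofNat_mem _ 2) (haR i)) (haR j))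
    split_ifs
    · exact one_mem _
    · exact zero_mem _
  | one =>
    intro i j
    rw [OneMemClass.coe_one, Matrix.one_apply]
    split_ifs
    · exact one_mem _
    · exact zero_mem _
  | mul g h _ _ hg hh =>
    intro i j
    rw [MulMemClass.coe_mul, Matrix.mul_apply]
    exact sum_mem fun k _ => mul_mem (hg i k) (hh k j)
  | inv g _ hg =>
    intro i j
    exact hg j i

theorem sum_sq_mulVec (g : OG4) (x : Fin 4 → ℝ) :
    ∑ i, (g : Matrix (Fin 4) (Fin 4) ℝ).mulVec x i ^ 2 = ∑ i, x i ^ 2 := by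
  have hg : (g : Matrix (Fin 4) (Fin 4) ℝ).transpose * g = 1 :=
    (Matrix.mem_orthogonalGroup_iff' (Fin 4) ℝ).1 g.2
  have h : ∀ v : Fin 4 → ℝ, ∑ i, v i ^ 2 = v ⬝ᵥ v := fun v => by
    simp only [dotProduct, sq]
  rw [h, h, Matrix.dotProduct_mulVec, Matrix.vecMul_mulVec, hg, Matrix.vecMul_one]

theorem sigmaSet_subset_unitVectors : SigmaSet ⊆ unitVectors := by
  rintro _ ⟨g, hg, a, ha, rfl⟩
  obtain ⟨ha1, haR⟩ := roots_subset_unitVectors ha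
  refine ⟨by rw [sum_sq_mulVec, ha1], fun i => ?_⟩
  rw [Matrix.mulVec, dotProduct, ← mem_dyadicGolden_iff]
  exact sum_mem fun k _ => mul_mem (entries_mem_of_mem_HinfG hg i k) (haR k)

theorem GoldenInt.IsDoubleRoot.scaledVec_mem {s : GoldenInt} (hs : IsGolden s)
    {b : Fin 4 → GoldenInt} (hb : IsDoubleRoot s b) :
    scaledVec 1 b ∈ DeltaSet gr ∪ DeltaSet (1 - gr) := by
  have h : scaledVec 1 b ∈ DeltaSet (toReal s) := by
    obtain ⟨σ, hσ, ε, hε, hb⟩ := hb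
    refine Or.inr (Or.inr ⟨σ, hσ, fun i => toReal (ε i), fun i => ?_, fun i => ?_⟩)
    · rcases hε i with h | h <;> simp [h]
    · rw [scaledVec, hb, map_mul, map_quad, pow_one]
      rfl
  rcases hs.toReal_eq with hs | hs <;> rw [hs] at h
  · exact Or.inl h
  · exact Or.inr h

theorem reflMat_mulVec_scaledVec {n : ℕ} {y b : Fin 4 → GoldenInt} {u : GoldenInt}
    (hu : ∑ i, y i * b i = 2 * u) :
    (reflMat (scaledVec 1 b)).mulVec (scaledVec n y) = scaledVec n fun i => y i - u * b i := by
  funext i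
  have h : ∑ j, scaledVec n y j * scaledVec 1 b j = toReal u / 2 ^ n := by
    have := congrArg toReal hu
    simp only [map_sum, map_mul, map_ofNat] at this
    simp only [scaledVec, div_mul_div_comm, ← Finset.sum_div, this]
    field_simp
  rw [reflMat_mulVec, h]
  simp only [scaledVec, map_sub, map_mul]
  ring

theorem sum_mul_self_reflect {y b : Fin 4 → GoldenInt} {u : GoldenInt}
    (hu : ∑ i, y i * b i = 2 * u) (hb : ∑ i, b i * b i = 4) :
    ∑ i, (y i - u * b i) * (y i - u * b i) = ∑ i, y i * y i := by
  have h : ∀ i, (y i - u * b i) * (y i - u * b i) =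
      y i * y i - 2 * u * (y i * b i) + u * u * (b i * b i) := fun i => by ring
  simp only [h, Finset.sum_add_distrib, Finset.sum_sub_distrib, ← Finset.mul_sum, hu, hb]
  ring

theorem scaledVec_mem_sigmaSet (n : ℕ) : ∀ y : Fin 4 → GoldenInt,
    ∑ i, y i * y i = 4 ^ n → scaledVec n y ∈ SigmaSet := by
  induction n with
  | zero =>
    intro y hy
    obtain ⟨i, hi, h0⟩ := exists_eq_one_of_sum_mul_self (hy.trans (pow_zero _))
    refine root_mem_sigmaSet (Or.inl (Or.inl ⟨i, ?_, fun j hj => by simp [scaledVec, h0 j hj]⟩))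
    rcases hi with hi | hi <;> simp [scaledVec, hi]
  | succ n ih =>
    have even : ∀ y : Fin 4 → GoldenInt, ∑ i, y i * y i = 4 ^ (n + 1) →
        (∀ i, residue (y i) = 0) → scaledVec (n + 1) y ∈ SigmaSet := by
      intro y hy h0
      choose z hz using fun i => (residue_eq_zero_iff _).1 (h0 i)
      obtain rfl : y = fun i => 2 * z i := funext hz
      have hsq := (sum_sq_scaledVec (n + 1) _).2 hy
      rw [scaledVec_succ_two_mul] at hsq ⊢
      exact ih z ((sum_sq_scaledVec n z).1 hsq)
    have nonscalar : ∀ y : Fin 4 → GoldenInt, ∑ i, y i * y i = 4 ^ (n + 1) →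
        ∀ s, IsGolden s → ∀ c d : GoldenResidue, d ≠ 0 →
        (∀ i, residue (y i) = c + d * quad (residue s) i) → scaledVec (n + 1) y ∈ SigmaSet := by
      intro y hy s hs c d hd h
      obtain ⟨b, hb, u, hu, hr⟩ := exists_doubleRoot_reduction hs hd h
      refine mem_sigmaSet_of_reflMat (hb.scaledVec_mem hs) ?_
      rw [reflMat_mulVec_scaledVec hu]
      exact even _ ((sum_mul_self_reflect hu (hb.sum_mul_self hs)).trans hy) hr
    intro y hy
    obtain ⟨s, hs, c, d, h⟩ := exists_residue_class hy
    by_cases hd : d = 0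
    · subst hd
      simp only [zero_mul, add_zero] at h
      by_cases hc : c = 0
      · exact even y hy fun i => (h i).trans hc
      · obtain ⟨b, hb, u, hu, hr⟩ := exists_doubleRoot_move hs hc h
        refine mem_sigmaSet_of_reflMat (hb.scaledVec_mem hs) ?_
        rw [reflMat_mulVec_scaledVec hu]
        exact nonscalar _ ((sum_mul_self_reflect hu (hb.sum_mul_self hs)).trans hy) s hs c (-1)
          (by decide) hr
    · exact nonscalar y hy s hs c d hd h

theorem unitVectors_subset_sigmaSet : unitVectors ⊆ SigmaSet := by
  rintro x ⟨hx, hR⟩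
  obtain ⟨n, y, rfl⟩ := exists_scaledVec hR
  exact scaledVec_mem_sigmaSet n y ((sum_sq_scaledVec n y).1 hx)

theorem exists_rep (c : GoldenResidue) : ∃ z, toReal z ∈ Reps ∧ residue z = c := by
  have h : ∀ c : GoldenResidue, c = 0 ∨ c = 1 ∨ c = residue ω ∨ c = residue (1 + ω) := by decide
  rcases h c with rfl | rfl | rfl | rfl
  · exact ⟨0, by simp [Reps], map_zero _⟩
  · exact ⟨1, by simp [Reps], map_one _⟩
  · exact ⟨ω, by simp [Reps, toReal_omega], rfl⟩
  · exact ⟨1 + ω, by simp [Reps, toReal_omega], rfl⟩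

theorem scaledVec_mem_sphS (n : ℕ) : ∀ y : Fin 4 → GoldenInt, ∑ i, y i * y i = 4 ^ n →
    ∃ m, scaledVec n y ∈ sphS gr m ∪ sphS (1 - gr) m := by
  induction n with
  | zero =>
    intro y hy
    obtain ⟨i, hi, h0⟩ := exists_eq_one_of_sum_mul_self (hy.trans (pow_zero _))
    refine ⟨0, Or.inl ⟨i, ?_, fun j hj => by simp [scaledVec, h0 j hj]⟩⟩
    rcases hi with hi | hi <;> simp [scaledVec, hi]
  | succ n ih =>
    intro y hy
    have hsq := (sum_sq_scaledVec (n + 1) y).2 hy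
    by_cases h0 : ∀ i, residue (y i) = 0
    · choose z hz using fun i => (residue_eq_zero_iff _).1 (h0 i)
      obtain rfl : y = fun i => 2 * z i := funext hz
      rw [scaledVec_succ_two_mul] at hsq ⊢
      exact ih z ((sum_sq_scaledVec n z).1 hsq)
    · push Not at h0
      obtain ⟨k, hk⟩ := h0
      obtain ⟨s, hs, c, d, h⟩ := exists_residue_class hy
      have hmem : scaledVec (n + 1) y ∈ sphS (toReal s) (n + 1) := by
        have hmul : ∀ i, 2 ^ (n + 1) * scaledVec (n + 1) y i = toReal (y i) := fun i =>
          mul_div_cancel₀ _ (by positivity)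
        refine ⟨hsq, fun i => ?_, ?_, k, ?_⟩
        · rw [hmul]
          exact ⟨(y i).re, (y i).im, rfl⟩
        · obtain ⟨c', hc', rfl⟩ := exists_rep c
          obtain ⟨d', hd', rfl⟩ := exists_rep d
          refine ⟨_, hc', _, hd', fun i => ?_⟩
          have hv : v4 (toReal s) i = toReal (quad s i) := (map_quad toReal s i).symm
          simp only [hmul]
          rw [hv, ← map_mul, ← map_add, cong2_toReal_iff, h, map_add, map_mul, map_quad]
        · rw [hmul, ← map_zero toReal, cong2_toReal_iff, map_zero]
          exact hk
      refine ⟨n + 1, ?_⟩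
      rcases hs.toReal_eq with hs | hs <;> rw [hs] at hmem
      · exact Or.inl hmem
      · exact Or.inr hmem

theorem sphS_subset_unitVectors (t : ℝ) (n : ℕ) : sphS t n ⊆ unitVectors := by
  cases n with
  | zero => exact fun x h => ⟨sum_sq_of_coordinate h, mem_dyadicGolden_of_coordinate h⟩
  | succ n =>
    rintro x ⟨hx, hZ, -, -⟩
    refine ⟨hx, fun i => ?_⟩
    obtain ⟨a, b, h⟩ := hZ i
    refine ⟨a, b, n + 1, ?_⟩
    rw [← h, mul_div_cancel_left₀ _ (by positivity)]

theorem iUnion_sphS : ⋃ n : ℕ, (sphS gr n ∪ sphS (1 - gr) n) = unitVectors := by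
  refine Set.Subset.antisymm (Set.iUnion_subset fun n =>
    Set.union_subset (sphS_subset_unitVectors _ n) (sphS_subset_unitVectors _ n)) ?_
  rintro x ⟨hx, hR⟩
  obtain ⟨n, y, rfl⟩ := exists_scaledVec hR
  exact Set.mem_iUnion.2 (scaledVec_mem_sphS n y ((sum_sq_scaledVec n y).1 hx))

theorem statement9 :
    SigmaSet = (⋃ n : ℕ, (sphS gr n ∪ sphS (1 - gr) n)) ∧
    SigmaSet = {x : Fin 4 → ℝ | (∑ i, x i ^ 2) = 1 ∧ ∀ i, x i ∈ Rgold} := by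
  have h : SigmaSet = unitVectors :=
    Set.Subset.antisymm sigmaSet_subset_unitVectors unitVectors_subset_sigmaSet
  exact ⟨h.trans iUnion_sphS.symm, h⟩
end
end

section
/- The set G = {γ_a : a ∈ 𝒮 ∩ ℛ⁴} of rotations of the pure quaternions induced by conjugation by unit quaternions with coordinates in ℛ is a subgroup of SO(3,ℛ), and its index in SO(3,ℛ) is exactly 2. -/
noncomputable section

/-- The basis (i, j, k) of the pure quaternions. -/
def basisQ : Fin 3 → Quaternion ℝ := ![⟨0, 1, 0, 0⟩, ⟨0, 0, 1, 0⟩, ⟨0, 0, 0, 1⟩]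

/-- The coordinates of the pure part of a quaternion in the basis (i, j, k). -/
def pureCoords (q : Quaternion ℝ) : Fin 3 → ℝ := ![q.imI, q.imJ, q.imK]

/-- The matrix, in the basis (i, j, k) of the pure quaternions, of the rotation
γ_a : x ↦ a x a⁻¹ induced by the unit quaternion a. -/
def rotMat (a : Quaternion ℝ) : Matrix (Fin 3) (Fin 3) ℝ :=
  Matrix.of fun i j => pureCoords (a * basisQ j * a⁻¹) i

/-- SO(3,ℛ): rotation matrices all of whose entries lie in ℛ. -/
def SO3R : Set (Matrix (Fin 3) (Fin 3) ℝ) :=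
  {M | M * M.transpose = 1 ∧ M.det = 1 ∧ ∀ i j, M i j ∈ Rgold}

/-- G = {γ_a : a ∈ 𝒮 ∩ ℛ⁴}, the rotations induced by unit quaternions with
coordinates in ℛ. -/
def Gset : Set (Matrix (Fin 3) (Fin 3) ℝ) :=
  {M | ∃ a : Quaternion ℝ, ‖a‖ = 1 ∧ a.re ∈ Rgold ∧ a.imI ∈ Rgold ∧
    a.imJ ∈ Rgold ∧ a.imK ∈ Rgold ∧ M = rotMat a}

/-- The ring `ℤ[τ]` of golden integers, with `τ ^ 2 = 1 + τ`. -/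
abbrev GoldInt : Type := QuadraticAlgebra ℤ 1 1

theorem gr_sq : gr ^ 2 = gr + 1 := Real.goldenRatio_sq

theorem gr_irrational : Irrational gr := Real.goldenRatio_irrational

namespace GoldInt

/-- The embedding of `ℤ[τ]` in the real numbers. -/
def toReal : GoldInt →+* ℝ where
  toFun z := z.re + z.im * gr
  map_one' := by simp [QuadraticAlgebra.re_one, QuadraticAlgebra.im_one]
  map_zero' := by simp
  map_add' x y := by simp only [QuadraticAlgebra.re_add, QuadraticAlgebra.im_add]; push_cast; ring
  map_mul' x y := by
    simp only [QuadraticAlgebra.re_mul, QuadraticAlgebra.im_mul]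
    push_cast
    linear_combination -(x.im * y.im : ℝ) * gr_sq

theorem toReal_apply (z : GoldInt) : toReal z = z.re + z.im * gr := rfl

theorem toReal_injective : Function.Injective toReal := by
  rw [injective_iff_map_eq_zero]
  intro z hz
  rw [toReal_apply] at hz
  have him : z.im = 0 := by
    by_contra h
    refine gr_irrational ⟨-z.re / z.im, ?_⟩
    have : (z.im : ℝ) ≠ 0 := by exact_mod_cast h
    push_cast
    field_simp
    linarith
  have hre : z.re = 0 := by
    rw [him] at hz
    simpa using hz
  ext <;> simp [him, hre]

instance : IsDomain GoldInt := toReal_injective.isDomain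

theorem norm_eq (z : GoldInt) : z.norm = z.re ^ 2 + z.re * z.im - z.im ^ 2 := by
  rw [QuadraticAlgebra.norm_def]; ring

theorem toReal_norm (z : GoldInt) : (z.norm : ℝ) = toReal z * toReal (star z) := by
  simp only [toReal_apply, norm_eq, QuadraticAlgebra.re_star, QuadraticAlgebra.im_star]
  push_cast
  linear_combination (z.im ^ 2 : ℝ) * gr_sq

theorem re_two : (2 : GoldInt).re = 2 := rfl

theorem im_two : (2 : GoldInt).im = 0 := rfl

theorem norm_ne_zero {z : GoldInt} (hz : z ≠ 0) : z.norm ≠ 0 := by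
  intro h
  have h1 := toReal_norm z
  rw [h, Int.cast_zero, zero_eq_mul, map_eq_zero_iff _ toReal_injective,
    map_eq_zero_iff _ toReal_injective, star_eq_zero] at h1
  tauto

/-- Division with remainder in `ℤ[τ]` with respect to the norm. -/
theorem exists_natAbs_norm_sub_mul_lt (x : GoldInt) {y : GoldInt} (hy : y ≠ 0) :
    ∃ q : GoldInt, (x - q * y).norm.natAbs < y.norm.natAbs := by
  have hN := norm_ne_zero hy
  set N := y.norm with hNdef
  set w := x * star y with hw
  have round (A : ℤ) : ∃ q : ℤ, |2 * (A - q * N)| ≤ |N| := by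
    refine ⟨round (A / N : ℚ), ?_⟩
    have h := abs_sub_round (A / N : ℚ)
    have hNq : (N : ℚ) ≠ 0 := by exact_mod_cast hN
    have h2 : (2 * (A - round (A / N : ℚ) * N) : ℚ) = 2 * (A / N - round (A / N : ℚ)) * N := by
      field_simp
    have : (|2 * (A - round (A / N : ℚ) * N)| : ℚ) ≤ |(N : ℚ)| := by
      rw [h2, abs_mul, abs_mul, abs_two]
      nlinarith [abs_nonneg (N : ℚ)]
    exact_mod_cast this
  obtain ⟨q₁, h₁⟩ := round w.re
  obtain ⟨q₂, h₂⟩ := round w.im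
  refine ⟨⟨q₁, q₂⟩, ?_⟩
  set r := x - ⟨q₁, q₂⟩ * y with hr
  have hyy : y * star y = ⟨N, 0⟩ := by
    rw [← QuadraticAlgebra.algebraMap_norm_eq_mul_star]; rfl
  have hrs : r * star y = ⟨w.re - q₁ * N, w.im - q₂ * N⟩ := by
    rw [hr, sub_mul, mul_assoc, hyy]
    ext <;> simp [hw]
  have hnorm : r.norm * N = (w.re - q₁ * N) ^ 2 + (w.re - q₁ * N) * (w.im - q₂ * N)
      - (w.im - q₂ * N) ^ 2 := by
    have h := congrArg QuadraticAlgebra.norm hrs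
    rw [map_mul, QuadraticAlgebra.norm_star] at h
    exact h.trans (norm_eq _)
  generalize w.re - q₁ * N = e at *
  generalize w.im - q₂ * N = f at *
  have hNpos : 0 < |N| := abs_pos.mpr hN
  have key : |r.norm| * |N| < |N| * |N| := by
    rw [← abs_mul, hnorm, abs_lt]
    have he := sq_le_sq.mpr h₁
    have hf := sq_le_sq.mpr h₂
    have hNN : |N| * |N| = N ^ 2 := by rw [← sq, sq_abs]
    have hN2 : 0 < N ^ 2 := by positivity
    rw [hNN]
    constructor <;> nlinarith [sq_nonneg (e - 2 * f), sq_nonneg (2 * e + f)]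
  zify
  exact lt_of_mul_lt_mul_right key hNpos.le

instance : IsPrincipalIdealRing GoldInt where
  principal I := by
    by_cases hI : I = ⊥
    · subst hI; infer_instance
    obtain ⟨x, hx, hx0⟩ := Submodule.exists_mem_ne_zero_of_ne_bot hI
    obtain ⟨g, ⟨hgI, hg0⟩, hmin⟩ := WellFounded.has_min
      (measure fun z : GoldInt => z.norm.natAbs).wf {z | z ∈ I ∧ z ≠ 0} ⟨x, hx, hx0⟩
    refine ⟨g, le_antisymm (fun z hz => ?_) ((Ideal.span_singleton_le_iff_mem I).mpr hgI)⟩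
    obtain ⟨q, hq⟩ := exists_natAbs_norm_sub_mul_lt z hg0
    by_cases h0 : z - q * g = 0
    · exact Ideal.mem_span_singleton'.mpr ⟨q, (sub_eq_zero.mp h0).symm⟩
    · exact absurd hq (hmin _ ⟨I.sub_mem hz (I.mul_mem_left q hgI), h0⟩)

/-- A totally positive unit of `ℤ[τ]` is the square of a unit. -/
theorem exists_sq_eq_of_norm_eq_one (n : ℕ) : ∀ u : GoldInt, u.im.natAbs = n → u.norm = 1 →
    0 < 2 * u.re + u.im → ∃ v : GoldInt, IsUnit v ∧ u = v ^ 2 := by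
  induction n using Nat.strong_induction_on with
  | _ n ih =>
  have pos (u : GoldInt) (hn : u.im.natAbs = n) (h0 : 0 < u.im) (h1 : u.norm = 1)
      (h2 : 0 < 2 * u.re + u.im) : ∃ v : GoldInt, IsUnit v ∧ u = v ^ 2 := by
    rw [norm_eq] at h1
    have hre : 0 < u.re := by nlinarith
    have hle : u.re ≤ u.im := by nlinarith
    obtain ⟨v, hv, huv⟩ := ih (u.im - u.re).natAbs (by omega) ⟨2 * u.re - u.im, u.im - u.re⟩ rfl
      (by rw [norm_eq]; linear_combination h1) (by dsimp only; nlinarith)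
    have hτ : (⟨0, 1⟩ * ⟨-1, 1⟩ : GoldInt) = 1 := by
      ext <;> simp [QuadraticAlgebra.re_one, QuadraticAlgebra.im_one]
    refine ⟨v * ⟨0, 1⟩, hv.mul (.of_mul_eq_one _ hτ), ?_⟩
    rw [mul_pow, ← huv]
    ext <;> simp [sq] <;> ring
  intro u hn h1 h2
  rcases lt_trichotomy u.im 0 with h0 | h0 | h0
  · obtain ⟨v, hv, huv⟩ := pos (star u) (by simpa using hn) (by simpa using h0)
      (by rw [QuadraticAlgebra.norm_star, h1])
      (by simp only [QuadraticAlgebra.re_star, QuadraticAlgebra.im_star]; omega)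
    exact ⟨star v, hv.star, by rw [← star_pow, ← huv, star_star]⟩
  · refine ⟨1, isUnit_one, ?_⟩
    rw [norm_eq, h0] at h1
    have : u.re = 1 := by nlinarith
    ext <;> simp [QuadraticAlgebra.re_one, QuadraticAlgebra.im_one, h0, this]
  · exact pos u hn h0 h1 h2

theorem two_dvd_iff (z : GoldInt) : 2 ∣ z ↔ 2 ∣ z.norm := by
  constructor
  · rintro ⟨w, rfl⟩
    rw [map_mul]
    exact Dvd.dvd.mul_right ⟨2, by simp [norm_eq, re_two, im_two]⟩ _
  · rw [norm_eq]
    intro h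
    have hre : 2 ∣ z.re ∧ 2 ∣ z.im := by
      rw [← even_iff_two_dvd] at h
      simp only [← even_iff_two_dvd]
      simp only [Int.even_sub, Int.even_add, Int.even_mul, Int.even_pow] at h
      tauto
    obtain ⟨⟨a, ha⟩, b, hb⟩ := hre
    exact ⟨⟨a, b⟩, by ext <;> simp [ha, hb, re_two, im_two]⟩

theorem two_dvd_or_of_two_dvd_mul {x y : GoldInt} (h : 2 ∣ x * y) : 2 ∣ x ∨ 2 ∣ y := by
  simp only [two_dvd_iff, map_mul] at h ⊢
  exact Int.prime_two.dvd_or_dvd h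

/-- A totally positive divisor of a power of two in `ℤ[τ]` is a power of two times the square of
a unit. -/
theorem exists_eq_two_pow_mul_sq (k : ℕ) : ∀ n r : GoldInt, n * r = 2 ^ k → 0 < toReal n →
    0 < toReal (star n) → ∃ (b : ℕ) (v : GoldInt), IsUnit v ∧ n = 2 ^ b * v ^ 2 := by
  induction k with
  | zero =>
    intro n r h h1 h2
    have hN : n.norm = 1 := by
      have hpos : 0 < n.norm := by
        have := mul_pos h1 h2
        rw [← toReal_norm] at this
        exact_mod_cast this
      have hu : IsUnit n.norm :=
        (IsUnit.of_mul_eq_one r (by simpa using h)).map QuadraticAlgebra.norm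
      rcases Int.isUnit_iff.mp hu with h | h <;> omega
    have htr : 0 < 2 * n.re + n.im := by
      have := add_pos h1 h2
      simp only [toReal_apply, QuadraticAlgebra.re_star, QuadraticAlgebra.im_star] at this
      push_cast at this
      have h3 : (0 : ℝ) < 2 * n.re + n.im := by linarith
      exact_mod_cast h3
    obtain ⟨v, hv, hnv⟩ := exists_sq_eq_of_norm_eq_one _ n rfl hN htr
    exact ⟨0, v, hv, by simpa using hnv⟩
  | succ k ih =>
    intro n r h h1 h2
    have h20 : (2 : GoldInt) ≠ 0 := by
      intro h
      simpa [re_two] using congrArg QuadraticAlgebra.re h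
    rcases two_dvd_or_of_two_dvd_mul (h ▸ dvd_pow_self 2 k.succ_ne_zero) with ⟨m, rfl⟩ | ⟨m, rfl⟩
    · have hs : star (2 : GoldInt) = 2 := star_ofNat 2
      rw [star_mul, hs, map_mul, map_ofNat] at h2
      rw [map_mul, map_ofNat] at h1
      obtain ⟨b, v, hv, hm⟩ := ih m r (mul_left_cancel₀ h20 (by rw [← mul_assoc, h]; ring))
        (by linarith) (by linarith)
      exact ⟨b + 1, v, hv, by rw [hm]; ring⟩
    · exact ih n m (mul_left_cancel₀ h20 (by linear_combination h)) h1 h2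

end GoldInt

theorem mem_Rgold_iff {x : ℝ} : x ∈ Rgold ↔ ∃ (z : GoldInt) (n : ℕ), x = GoldInt.toReal z / 2 ^ n :=
  ⟨fun ⟨a, b, n, h⟩ => ⟨⟨a, b⟩, n, h⟩, fun ⟨z, n, h⟩ => ⟨z.re, z.im, n, h⟩⟩

theorem toReal_mem_Rgold (z : GoldInt) : GoldInt.toReal z ∈ Rgold :=
  mem_Rgold_iff.mpr ⟨z, 0, by simp⟩

/-- The ring of dyadic golden numbers as a subring of `ℝ`. -/
def goldSubring : Subring ℝ where
  carrier := Rgold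
  one_mem' := by simpa using toReal_mem_Rgold 1
  zero_mem' := by simpa using toReal_mem_Rgold 0
  neg_mem' {x} hx := by
    obtain ⟨z, n, rfl⟩ := mem_Rgold_iff.mp hx
    exact mem_Rgold_iff.mpr ⟨-z, n, by rw [map_neg, neg_div]⟩
  add_mem' {x y} hx hy := by
    obtain ⟨z, n, rfl⟩ := mem_Rgold_iff.mp hx
    obtain ⟨w, m, rfl⟩ := mem_Rgold_iff.mp hy
    refine mem_Rgold_iff.mpr ⟨z * 2 ^ m + w * 2 ^ n, n + m, ?_⟩
    simp only [map_add, map_mul, map_pow, map_ofNat]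
    field_simp
    ring
  mul_mem' {x y} hx hy := by
    obtain ⟨z, n, rfl⟩ := mem_Rgold_iff.mp hx
    obtain ⟨w, m, rfl⟩ := mem_Rgold_iff.mp hy
    refine mem_Rgold_iff.mpr ⟨z * w, n + m, ?_⟩
    rw [map_mul]
    field_simp
    ring

theorem mem_goldSubring {x : ℝ} : x ∈ goldSubring ↔ x ∈ Rgold := Iff.rfl

theorem half_mem_goldSubring : (1 / 2 : ℝ) ∈ goldSubring :=
  mem_Rgold_iff.mpr ⟨1, 1, by simp⟩

/-- No dyadic golden number is a square root of `1 / 2`. -/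
theorem two_mul_sq_ne_one_of_mem_Rgold {x : ℝ} (hx : x ∈ Rgold) : 2 * x ^ 2 ≠ 1 := by
  intro h
  obtain ⟨z, n, rfl⟩ := mem_Rgold_iff.mp hx
  have h1 : 2 * z ^ 2 = 4 ^ n := by
    apply GoldInt.toReal_injective
    simp only [map_mul, map_pow, map_ofNat]
    rw [div_pow, ← pow_mul, mul_comm n 2, pow_mul] at h
    field_simp at h
    rw [h]; norm_num
  have hre := congrArg QuadraticAlgebra.re h1
  have him := congrArg QuadraticAlgebra.im h1
  have h4 : (4 ^ n : GoldInt) = ((4 ^ n : ℤ) : GoldInt) := by push_cast; rfl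
  rw [h4, QuadraticAlgebra.re_intCast] at hre
  rw [h4, QuadraticAlgebra.im_intCast] at him
  simp only [sq, QuadraticAlgebra.re_mul, QuadraticAlgebra.im_mul, GoldInt.re_two,
    GoldInt.im_two, Int.cast_id] at hre him
  have him' : z.im * (2 * z.re + z.im) = 0 := by linarith
  rcases mul_eq_zero.mp him' with h0 | h0
  · rw [h0] at hre
    have h2 : (2 * z.re ^ 2 : ℝ) = (2 ^ n) ^ 2 := by
      rw [← pow_mul, mul_comm n 2, pow_mul]
      norm_num
      have : 2 * z.re ^ 2 = 4 ^ n := by linarith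
      exact_mod_cast this
    have hz0 : (z.re : ℝ) ≠ 0 := by
      intro h
      rw [h] at h2
      have : (0 : ℝ) < (2 ^ n) ^ 2 := by positivity
      linarith
    refine irrational_sqrt_two ⟨2 ^ n / |z.re|, ?_⟩
    push_cast
    rw [← Real.sqrt_sq (by positivity : (0 : ℝ) ≤ 2 ^ n / |(z.re : ℝ)|), div_pow, sq_abs, ← h2]
    congr 1
    field_simp
  · have h2 : (5 : ℤ) ∣ 4 ^ n := by
      have : z.im = -2 * z.re := by linarith
      rw [this] at hre
      exact ⟨2 * z.re ^ 2, by linarith⟩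
    have := Int.Prime.dvd_pow' (by norm_num : Nat.Prime 5) h2
    norm_num at this

/-- The homogeneous quadratic (Euler–Rodrigues) form of the rotation matrix of a quaternion. -/
def eulerMat (w x y z : ℝ) : Matrix (Fin 3) (Fin 3) ℝ :=
  !![w ^ 2 + x ^ 2 - y ^ 2 - z ^ 2, 2 * (x * y - w * z), 2 * (x * z + w * y);
    2 * (x * y + w * z), w ^ 2 - x ^ 2 + y ^ 2 - z ^ 2, 2 * (y * z - w * x);
    2 * (x * z - w * y), 2 * (y * z + w * x), w ^ 2 - x ^ 2 - y ^ 2 + z ^ 2]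

open Quaternion

theorem rotMat_eq (a : ℍ[ℝ]) :
    rotMat a = (normSq a)⁻¹ • eulerMat a.re a.imI a.imJ a.imK := by
  ext i j
  fin_cases i <;> fin_cases j <;>
    simp [rotMat, pureCoords, basisQ, eulerMat, Quaternion.inv_def] <;> left <;> ring

theorem rotMat_mul (a b : ℍ[ℝ]) : rotMat (a * b) = rotMat a * rotMat b := by
  simp only [rotMat_eq, map_mul, mul_inv, Matrix.smul_mul, Matrix.mul_smul, smul_smul]
  rw [mul_comm]
  congr 1
  ext i j
  fin_cases i <;> fin_cases j <;>
    simp [eulerMat, Matrix.mul_apply, Fin.sum_univ_three] <;> ring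

theorem rotMat_one : rotMat 1 = 1 := by
  ext i j
  fin_cases i <;> fin_cases j <;> simp [rotMat_eq, eulerMat]

theorem rotMat_smul {c : ℝ} (hc : c ≠ 0) (a : ℍ[ℝ]) : rotMat (c • a) = rotMat a := by
  have h : eulerMat (c * a.re) (c * a.imI) (c * a.imJ) (c * a.imK) =
      c ^ 2 • eulerMat a.re a.imI a.imJ a.imK := by
    ext i j
    fin_cases i <;> fin_cases j <;> simp [eulerMat] <;> ring
  simp only [rotMat_eq, normSq_smul, re_smul, imI_smul, imJ_smul, imK_smul, smul_eq_mul, h,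
    smul_smul]
  congr 1
  field_simp

theorem rotMat_mul_transpose {a : ℍ[ℝ]} (ha : a ≠ 0) :
    rotMat a * (rotMat a).transpose = 1 := by
  have h : eulerMat a.re a.imI a.imJ a.imK * (eulerMat a.re a.imI a.imJ a.imK).transpose =
      (normSq a) ^ 2 • 1 := by
    rw [normSq_def']
    ext i j
    fin_cases i <;> fin_cases j <;>
      simp [eulerMat, Matrix.mul_apply, Fin.sum_univ_three] <;> ring
  have hn : normSq a ≠ 0 := normSq_ne_zero.mpr ha
  rw [rotMat_eq, Matrix.transpose_smul, Matrix.smul_mul, Matrix.mul_smul, h, smul_smul, smul_smul]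
  field_simp
  simp

theorem det_rotMat {a : ℍ[ℝ]} (ha : a ≠ 0) : (rotMat a).det = 1 := by
  have h : (eulerMat a.re a.imI a.imJ a.imK).det = normSq a ^ 3 := by
    rw [normSq_def', Matrix.det_fin_three]
    simp [eulerMat]
    ring
  have hn : normSq a ≠ 0 := normSq_ne_zero.mpr ha
  rw [rotMat_eq, Matrix.det_smul, h]
  simp [hn]

/-- The set of quaternions with coordinates in `ℛ`. -/
def goldQuaternions : Set ℍ[ℝ] :=
  {a | a.re ∈ goldSubring ∧ a.imI ∈ goldSubring ∧ a.imJ ∈ goldSubring ∧ a.imK ∈ goldSubring}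

theorem mul_mem_goldQuaternions {a b : ℍ[ℝ]} (ha : a ∈ goldQuaternions)
    (hb : b ∈ goldQuaternions) : a * b ∈ goldQuaternions := by
  obtain ⟨h1, h2, h3, h4⟩ := ha
  obtain ⟨k1, k2, k3, k4⟩ := hb
  have m {x y : ℝ} (hx : x ∈ goldSubring) (hy : y ∈ goldSubring) := goldSubring.mul_mem hx hy
  simp only [goldQuaternions, Set.mem_ofPred_eq, re_mul, imI_mul, imJ_mul, imK_mul]
  refine ⟨?_, ?_, ?_, ?_⟩ <;>
    repeat' first | apply goldSubring.sub_mem | apply goldSubring.add_mem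
  all_goals exact m ‹_› ‹_›

theorem star_mem_goldQuaternions {a : ℍ[ℝ]} (ha : a ∈ goldQuaternions) :
    star a ∈ goldQuaternions := by
  obtain ⟨h1, h2, h3, h4⟩ := ha
  simp only [goldQuaternions, Set.mem_ofPred_eq, re_star, imI_star, imJ_star, imK_star, neg_mem_iff]
  exact ⟨h1, h2, h3, h4⟩

theorem smul_mem_goldQuaternions {c : ℝ} {a : ℍ[ℝ]} (hc : c ∈ goldSubring)
    (ha : a ∈ goldQuaternions) : c • a ∈ goldQuaternions :=
  ⟨mul_mem hc ha.1, mul_mem hc ha.2.1, mul_mem hc ha.2.2.1, mul_mem hc ha.2.2.2⟩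

theorem mem_Gset_iff {M : Matrix (Fin 3) (Fin 3) ℝ} :
    M ∈ Gset ↔ ∃ a ∈ goldQuaternions, normSq a = 1 ∧ M = rotMat a := by
  have h (a : ℍ[ℝ]) : ‖a‖ = 1 ↔ normSq a = 1 := by
    rw [normSq_eq_norm_mul_self, mul_self_eq_one_iff]
    constructor
    · exact Or.inl
    · rintro (h | h)
      · exact h
      · linarith [norm_nonneg a]
  constructor
  · rintro ⟨a, h0, h1, h2, h3, h4, rfl⟩
    exact ⟨a, ⟨h1, h2, h3, h4⟩, (h a).mp h0, rfl⟩
  · rintro ⟨a, ⟨h1, h2, h3, h4⟩, h0, rfl⟩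
    exact ⟨a, (h a).mpr h0, h1, h2, h3, h4, rfl⟩

theorem rotMat_mem_Gset_of_normSq_eq_sq {a : ℍ[ℝ]} (ha : a ∈ goldQuaternions) {s : ℝ}
    (hs0 : s ≠ 0) (hs : s⁻¹ ∈ goldSubring) (h : normSq a = s ^ 2) : rotMat a ∈ Gset := by
  refine mem_Gset_iff.mpr ⟨s⁻¹ • a, smul_mem_goldQuaternions hs ha, ?_,
    (rotMat_smul (inv_ne_zero hs0) a).symm⟩
  rw [normSq_smul, h]
  field_simp

theorem rotMat_mem_SO3R {a : ℍ[ℝ]} (ha : a ∈ goldQuaternions)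
    (hs : (normSq a)⁻¹ ∈ goldSubring) (ha0 : a ≠ 0) : rotMat a ∈ SO3R := by
  refine ⟨rotMat_mul_transpose ha0, det_rotMat ha0, fun i j => ?_⟩
  obtain ⟨h1, h2, h3, h4⟩ := ha
  have m {x y : ℝ} (hx : x ∈ goldSubring) (hy : y ∈ goldSubring) := goldSubring.mul_mem hx hy
  have p {x : ℝ} (hx : x ∈ goldSubring) := goldSubring.pow_mem hx 2
  have h2' : (2 : ℝ) ∈ goldSubring := ofNat_mem goldSubring 2
  rw [rotMat_eq, ← mem_goldSubring]
  refine goldSubring.mul_mem hs ?_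
  fin_cases i <;> fin_cases j <;> simp [eulerMat] <;>
    first
      | (refine m h2' ?_; first | apply goldSubring.sub_mem | apply goldSubring.add_mem) <;>
          exact m ‹_› ‹_›
      | repeat' first | apply p | apply goldSubring.sub_mem | apply goldSubring.add_mem
  all_goals assumption

theorem Gset_subset_SO3R : Gset ⊆ SO3R := by
  intro M hM
  obtain ⟨a, ha, h1, rfl⟩ := mem_Gset_iff.mp hM
  refine rotMat_mem_SO3R ha (by rw [h1, inv_one]; exact one_mem _) ?_
  rintro rfl
  simp at h1

theorem one_mem_goldQuaternions : (1 : ℍ[ℝ]) ∈ goldQuaternions := by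
  simp [goldQuaternions, goldSubring.one_mem, goldSubring.zero_mem]

theorem one_mem_Gset : (1 : Matrix (Fin 3) (Fin 3) ℝ) ∈ Gset :=
  mem_Gset_iff.mpr ⟨1, one_mem_goldQuaternions, by simp, rotMat_one.symm⟩

theorem mul_mem_Gset {M N : Matrix (Fin 3) (Fin 3) ℝ} (hM : M ∈ Gset) (hN : N ∈ Gset) :
    M * N ∈ Gset := by
  obtain ⟨a, ha, h1, rfl⟩ := mem_Gset_iff.mp hM
  obtain ⟨b, hb, h2, rfl⟩ := mem_Gset_iff.mp hN
  exact mem_Gset_iff.mpr ⟨a * b, mul_mem_goldQuaternions ha hb, by rw [map_mul, h1, h2, one_mul],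
    (rotMat_mul a b).symm⟩

theorem exists_inv_mem_Gset {M : Matrix (Fin 3) (Fin 3) ℝ} (hM : M ∈ Gset) :
    ∃ N ∈ Gset, M * N = 1 ∧ N * M = 1 := by
  obtain ⟨a, ha, h1, rfl⟩ := mem_Gset_iff.mp hM
  refine ⟨rotMat (star a), mem_Gset_iff.mpr ⟨star a, star_mem_goldQuaternions ha,
    by rw [normSq_star, h1], rfl⟩, ?_, ?_⟩
  · rw [← rotMat_mul, self_mul_star, h1, coe_one, rotMat_one]
  · rw [← rotMat_mul, star_mul_self, h1, coe_one, rotMat_one]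

/-- The quaternion `1 + i`. -/
def oneAddI : ℍ[ℝ] := ⟨1, 1, 0, 0⟩

@[simp] theorem re_oneAddI : oneAddI.re = 1 := rfl

@[simp] theorem imI_oneAddI : oneAddI.imI = 1 := rfl

@[simp] theorem imJ_oneAddI : oneAddI.imJ = 0 := rfl

@[simp] theorem imK_oneAddI : oneAddI.imK = 0 := rfl

theorem normSq_oneAddI : normSq oneAddI = 2 := by
  rw [normSq_def']
  norm_num

theorem oneAddI_mem_goldQuaternions : oneAddI ∈ goldQuaternions :=
  ⟨one_mem _, one_mem _, zero_mem _, zero_mem _⟩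

theorem rotMat_oneAddI_notMem_Gset : rotMat oneAddI ∉ Gset := by
  intro h
  obtain ⟨a, ha, h1, h2⟩ := mem_Gset_iff.mp h
  have e0 := congrFun₂ h2 0 0
  have e1 := congrFun₂ h2 1 1
  have e2 := congrFun₂ h2 2 2
  rw [rotMat_eq, rotMat_eq, h1, normSq_oneAddI] at e0 e1 e2
  rw [normSq_def'] at h1
  simp [eulerMat] at e0 e1 e2
  norm_num at e0 e1 e2
  exact two_mul_sq_ne_one_of_mem_Rgold ha.1 (by linarith)

theorem rotMat_oneAddI_mem_SO3R : rotMat oneAddI ∈ SO3R := by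
  refine rotMat_mem_SO3R oneAddI_mem_goldQuaternions ?_ ?_
  · rw [normSq_oneAddI, ← one_div]
    exact half_mem_goldSubring
  · intro h
    simpa [h] using normSq_oneAddI

/-- The matrix attached to `M` whose `(i, j)` entry is `4 qᵢ qⱼ` when `M` is the rotation matrix
of the unit quaternion `q`. -/
def quatGram (M : Matrix (Fin 3) (Fin 3) ℝ) : Matrix (Fin 4) (Fin 4) ℝ :=
  !![1 + M 0 0 + M 1 1 + M 2 2, M 2 1 - M 1 2, M 0 2 - M 2 0, M 1 0 - M 0 1;
    M 2 1 - M 1 2, 1 + M 0 0 - M 1 1 - M 2 2, M 0 1 + M 1 0, M 0 2 + M 2 0;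
    M 0 2 - M 2 0, M 0 1 + M 1 0, 1 - M 0 0 + M 1 1 - M 2 2, M 1 2 + M 2 1;
    M 1 0 - M 0 1, M 0 2 + M 2 0, M 1 2 + M 2 1, 1 - M 0 0 - M 1 1 + M 2 2]

theorem quatGram_mul_quatGram {M : Matrix (Fin 3) (Fin 3) ℝ} (h : M * M.transpose = 1)
    (hdet : M.det = 1) (i j k : Fin 4) :
    quatGram M i j * quatGram M i k = quatGram M i i * quatGram M j k := by
  have h' : M.transpose * M = 1 := mul_eq_one_comm.mp h
  have hadj : M.adjugate = M.transpose := by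
    calc M.adjugate = M.transpose * M * M.adjugate := by rw [h', one_mul]
      _ = M.transpose := by rw [mul_assoc, Matrix.mul_adjugate, hdet, one_smul, mul_one]
  have row (a b : Fin 3) := congrFun₂ h a b
  have col (a b : Fin 3) := congrFun₂ h' a b
  have adj (a b : Fin 3) := congrFun₂ hadj a b
  rw [Matrix.adjugate_fin_three] at adj
  simp only [Matrix.mul_apply, Fin.sum_univ_three, Matrix.transpose_apply] at row col adj
  have r00 := row 0 0
  have r11 := row 1 1
  have r22 := row 2 2
  have r01 := row 0 1
  have r02 := row 0 2
  have r12 := row 1 2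
  have c00 := col 0 0
  have c11 := col 1 1
  have c22 := col 2 2
  have c01 := col 0 1
  have c02 := col 0 2
  have c12 := col 1 2
  have a00 := adj 0 0
  have a01 := adj 0 1
  have a02 := adj 0 2
  have a10 := adj 1 0
  have a11 := adj 1 1
  have a12 := adj 1 2
  have a20 := adj 2 0
  have a21 := adj 2 1
  have a22 := adj 2 2
  simp at r00 r11 r22 r01 r02 r12 c00 c11 c22 c01 c02 c12 a00 a01 a02 a10 a11 a12 a20 a21 a22
  clear row col adj h h' hadj hdet
  fin_cases i <;> fin_cases j <;> fin_cases k <;> simp [quatGram] <;> linarith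

theorem exists_quatGram_diag_ne_zero (M : Matrix (Fin 3) (Fin 3) ℝ) :
    ∃ i, quatGram M i i ≠ 0 := by
  by_contra! h
  have h0 := h 0
  have h1 := h 1
  have h2 := h 2
  have h3 := h 3
  simp [quatGram] at h0 h1 h2 h3
  linarith

theorem quatGram_mem_goldSubring {M : Matrix (Fin 3) (Fin 3) ℝ} (hM : ∀ i j, M i j ∈ Rgold)
    (i j : Fin 4) : quatGram M i j ∈ goldSubring := by
  have h1 : (1 : ℝ) ∈ goldSubring := one_mem _
  fin_cases i <;> fin_cases j <;> simp [quatGram] <;>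
    repeat' first | exact hM _ _ | exact h1 | apply goldSubring.sub_mem | apply goldSubring.add_mem

/-- The quaternion with the given vector of coordinates. -/
def quatOfFn (p : Fin 4 → ℝ) : ℍ[ℝ] := ⟨p 0, p 1, p 2, p 3⟩

@[simp] theorem re_quatOfFn (p : Fin 4 → ℝ) : (quatOfFn p).re = p 0 := rfl

@[simp] theorem imI_quatOfFn (p : Fin 4 → ℝ) : (quatOfFn p).imI = p 1 := rfl

@[simp] theorem imJ_quatOfFn (p : Fin 4 → ℝ) : (quatOfFn p).imJ = p 2 := rfl

@[simp] theorem imK_quatOfFn (p : Fin 4 → ℝ) : (quatOfFn p).imK = p 3 := rfl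

theorem normSq_quatOfFn (p : Fin 4 → ℝ) : normSq (quatOfFn p) = ∑ i, p i ^ 2 := by
  simp [normSq_def', Fin.sum_univ_four]

theorem normSq_quatOfFn_of_quatGram {M : Matrix (Fin 3) (Fin 3) ℝ} {p : Fin 4 → ℝ} {d : ℝ}
    (h : ∀ j k, p j * p k = d * quatGram M j k) : normSq (quatOfFn p) = 4 * d := by
  have h0 := h 0 0
  have h1 := h 1 1
  have h2 := h 2 2
  have h3 := h 3 3
  simp [quatGram] at h0 h1 h2 h3
  rw [normSq_def', re_quatOfFn, imI_quatOfFn, imJ_quatOfFn, imK_quatOfFn]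
  linarith

theorem rotMat_quatOfFn_of_quatGram {M : Matrix (Fin 3) (Fin 3) ℝ} {p : Fin 4 → ℝ} {d : ℝ}
    (hd : d ≠ 0) (h : ∀ j k, p j * p k = d * quatGram M j k) : rotMat (quatOfFn p) = M := by
  have key : eulerMat (p 0) (p 1) (p 2) (p 3) = (4 * d) • M := by
    have h00 := h 0 0
    have h01 := h 0 1
    have h02 := h 0 2
    have h03 := h 0 3
    have h11 := h 1 1
    have h12 := h 1 2
    have h13 := h 1 3
    have h22 := h 2 2
    have h23 := h 2 3
    have h33 := h 3 3
    simp [quatGram] at h00 h01 h02 h03 h11 h12 h13 h22 h23 h33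
    ext i j
    fin_cases i <;> fin_cases j <;> simp [eulerMat] <;> linarith
  rw [rotMat_eq, normSq_quatOfFn_of_quatGram h, re_quatOfFn, imI_quatOfFn, imJ_quatOfFn,
    imK_quatOfFn, key, smul_smul, inv_mul_cancel₀ (by positivity), one_smul]

theorem exists_common_denominator {ι : Type*} [Fintype ι] {x : ι → ℝ} (hx : ∀ i, x i ∈ Rgold) :
    ∃ (n : ℕ) (z : ι → GoldInt), ∀ i, 2 ^ n * x i = GoldInt.toReal (z i) := by
  choose z n h using fun i => mem_Rgold_iff.mp (hx i)
  refine ⟨∑ i, n i, fun i => z i * 2 ^ (∑ i, n i - n i), fun i => ?_⟩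
  have hle : n i ≤ ∑ i, n i := Finset.single_le_sum (fun _ _ => Nat.zero_le _) (Finset.mem_univ i)
  rw [h, map_mul, map_pow, map_ofNat, ← Nat.sub_add_cancel hle, pow_add, Nat.add_sub_cancel]
  field_simp

theorem exists_eq_mul_and_sum_mul_eq_one {R ι : Type*} [CommRing R] [IsDomain R]
    [IsPrincipalIdealRing R] [Fintype ι] {p : ι → R} (hp : p ≠ 0) :
    ∃ (g : R) (q c : ι → R), g ≠ 0 ∧ (∀ i, p i = g * q i) ∧ ∑ i, c i * q i = 1 := by
  obtain ⟨g, hg⟩ := IsPrincipalIdealRing.principal (Ideal.span (Set.range p))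
  have hmem (i : ι) : ∃ q, p i = g * q := by
    have : p i ∈ Ideal.span (Set.range p) := Ideal.subset_span ⟨i, rfl⟩
    rw [hg] at this
    exact Ideal.mem_span_singleton.mp this
  choose q hq using hmem
  have hgp : g ∈ Ideal.span (Set.range p) := hg ▸ Ideal.mem_span_singleton_self g
  obtain ⟨c, hc⟩ := Ideal.mem_span_range_iff_exists_fun.mp hgp
  have hg0 : g ≠ 0 := by
    rintro rfl
    exact hp (funext fun i => by rw [hq, zero_mul, Pi.zero_apply])
  refine ⟨g, q, c, hg0, hq, mul_left_cancel₀ hg0 ?_⟩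
  rw [mul_one, Finset.mul_sum]
  refine Eq.trans (Finset.sum_congr rfl fun i _ => ?_) hc
  rw [hq]
  ring

/-- A rotation with entries in `ℛ` is described by a primitive vector of golden integers. -/
theorem exists_primitive_of_mem_SO3R {M : Matrix (Fin 3) (Fin 3) ℝ} (hM : M ∈ SO3R) :
    ∃ (q c : Fin 4 → GoldInt) (d : ℝ), d ≠ 0 ∧ ∑ i, c i * q i = 1 ∧
      ∀ j k, GoldInt.toReal (q j) * GoldInt.toReal (q k) = d * quatGram M j k := by
  obtain ⟨horth, hdet, hR⟩ := hM
  obtain ⟨i, hi⟩ := exists_quatGram_diag_ne_zero M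
  obtain ⟨n, p, hp⟩ := exists_common_denominator (quatGram_mem_goldSubring hR i)
  have hp0 : p ≠ 0 := by
    rintro rfl
    have := hp i
    simp [hi] at this
  obtain ⟨g, q, c, hg0, hgq, hc⟩ := exists_eq_mul_and_sum_mul_eq_one hp0
  have hg : GoldInt.toReal g ≠ 0 := (map_ne_zero_iff _ GoldInt.toReal_injective).mpr hg0
  refine ⟨q, c, (2 ^ n) ^ 2 * quatGram M i i / GoldInt.toReal g ^ 2, by positivity, hc,
    fun j k => ?_⟩
  have hj := hp j
  have hk := hp k
  rw [hgq, map_mul] at hj hk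
  field_simp
  linear_combination (2 ^ n) ^ 2 * quatGram_mul_quatGram horth hdet i j k
    - 2 ^ n * quatGram M i k * hj - GoldInt.toReal g * GoldInt.toReal (q j) * hk

theorem GoldInt.sum_sq_pos {ι : Type*} [Fintype ι] {q : ι → GoldInt} (hq : q ≠ 0)
    {f : GoldInt → ℝ} (hf : ∀ z, f z = 0 → z = 0) : 0 < ∑ i, f (q i) ^ 2 := by
  obtain ⟨i, hi⟩ := Function.ne_iff.mp hq
  refine Finset.sum_pos' (fun _ _ => sq_nonneg _) ⟨i, Finset.mem_univ i, ?_⟩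
  have : f (q i) ≠ 0 := fun h => hi (hf _ h)
  positivity

theorem mem_Gset_or_exists_of_mem_SO3R {M : Matrix (Fin 3) (Fin 3) ℝ} (hM : M ∈ SO3R) :
    M ∈ Gset ∨ ∃ N ∈ Gset, M = rotMat oneAddI * N := by
  obtain ⟨q, c, d, hd, hc, hqd⟩ := exists_primitive_of_mem_SO3R hM
  set a := quatOfFn fun i => GoldInt.toReal (q i) with ha
  have haM : rotMat a = M := rotMat_quatOfFn_of_quatGram hd hqd
  have hnd : normSq a = 4 * d := normSq_quatOfFn_of_quatGram hqd
  have hn : normSq a = GoldInt.toReal (∑ i, q i ^ 2) := by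
    rw [ha, normSq_quatOfFn, map_sum]
    simp only [map_pow]
  have hag : a ∈ goldQuaternions :=
    ⟨toReal_mem_Rgold _, toReal_mem_Rgold _, toReal_mem_Rgold _, toReal_mem_Rgold _⟩
  have hq0 : q ≠ 0 := by
    rintro rfl
    simp at hc
  have hinj (z : GoldInt) (h : GoldInt.toReal z = 0) : z = 0 :=
    (map_eq_zero_iff _ GoldInt.toReal_injective).mp h
  have hpos : 0 < GoldInt.toReal (∑ i, q i ^ 2) := by
    simpa only [map_sum, map_pow] using GoldInt.sum_sq_pos hq0 hinj
  have hpos' : 0 < GoldInt.toReal (star (∑ i, q i ^ 2)) := by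
    simpa only [star_sum, star_pow, map_sum, map_pow] using
      GoldInt.sum_sq_pos hq0 (f := fun z => GoldInt.toReal (star z))
        fun z h => star_eq_zero.mp (hinj _ h)
  have hs : ∑ j, ∑ k, GoldInt.toReal (c j) * GoldInt.toReal (c k) * quatGram M j k ∈ goldSubring :=
    sum_mem fun j _ => sum_mem fun k _ => mul_mem
      (mul_mem (toReal_mem_Rgold _) (toReal_mem_Rgold _)) (quatGram_mem_goldSubring hM.2.2 j k)
  have hds : d * ∑ j, ∑ k, GoldInt.toReal (c j) * GoldInt.toReal (c k) * quatGram M j k = 1 := by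
    have h1 := congrArg GoldInt.toReal hc
    rw [map_one, map_sum] at h1
    simp only [map_mul] at h1
    calc _ = (∑ i, GoldInt.toReal (c i) * GoldInt.toReal (q i)) *
          ∑ i, GoldInt.toReal (c i) * GoldInt.toReal (q i) := by
          rw [Finset.sum_mul_sum, Finset.mul_sum]
          refine Finset.sum_congr rfl fun j _ => ?_
          rw [Finset.mul_sum]
          refine Finset.sum_congr rfl fun k _ => ?_
          linear_combination -GoldInt.toReal (c j) * GoldInt.toReal (c k) * hqd j k
      _ = 1 := by rw [h1, one_mul]
  obtain ⟨r, k, hr⟩ := mem_Rgold_iff.mp hs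
  rw [hr] at hds
  have hdvd : (∑ i, q i ^ 2) * r = 2 ^ (k + 2) := by
    apply GoldInt.toReal_injective
    rw [map_mul, ← hn, hnd, map_pow, map_ofNat, pow_add]
    field_simp at hds
    linear_combination 4 * hds
  obtain ⟨b, v, hv, hbv⟩ := GoldInt.exists_eq_two_pow_mul_sq _ _ r hdvd hpos hpos'
  rw [hbv, map_mul, map_pow, map_pow, map_ofNat] at hn
  have hV0 : GoldInt.toReal v ≠ 0 := (hv.map GoldInt.toReal).ne_zero
  have hsinv (m : ℕ) : (2 ^ m * GoldInt.toReal v)⁻¹ ∈ goldSubring := by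
    obtain ⟨w, hw⟩ := hv.exists_right_inv
    refine mem_Rgold_iff.mpr ⟨w, m, ?_⟩
    have hw' := congrArg GoldInt.toReal hw
    rw [map_mul, map_one] at hw'
    field_simp
    linear_combination -hw'
  rcases Nat.even_or_odd' b with ⟨m, rfl | rfl⟩
  · left
    rw [← haM]
    refine rotMat_mem_Gset_of_normSq_eq_sq hag (s := 2 ^ m * GoldInt.toReal v) (by positivity)
      (hsinv m) ?_
    rw [hn]
    ring
  · right
    refine ⟨rotMat (star oneAddI * a), rotMat_mem_Gset_of_normSq_eq_sq
      (mul_mem_goldQuaternions (star_mem_goldQuaternions oneAddI_mem_goldQuaternions) hag)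
      (s := 2 ^ (m + 1) * GoldInt.toReal v) (by positivity) (hsinv _) ?_, ?_⟩
    · rw [map_mul, normSq_star, normSq_oneAddI, hn]
      ring
    · rw [← rotMat_mul, ← mul_assoc, self_mul_star, normSq_oneAddI, coe_mul_eq_smul,
        rotMat_smul two_ne_zero, haM]

theorem statement16 :
    Gset ⊆ SO3R ∧
    (1 : Matrix (Fin 3) (Fin 3) ℝ) ∈ Gset ∧
    (∀ M ∈ Gset, ∀ N ∈ Gset, M * N ∈ Gset) ∧
    (∀ M ∈ Gset, ∃ N ∈ Gset, M * N = 1 ∧ N * M = 1) ∧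
    (∃ M₀ ∈ SO3R, M₀ ∉ Gset ∧ ∀ M ∈ SO3R, M ∈ Gset ∨ ∃ N ∈ Gset, M = M₀ * N) :=
  ⟨Gset_subset_SO3R, one_mem_Gset, fun _ hM _ hN => mul_mem_Gset hM hN,
    fun _ hM => exists_inv_mem_Gset hM, rotMat oneAddI, rotMat_oneAddI_mem_SO3R,
    rotMat_oneAddI_notMem_Gset, fun _ hM => mem_Gset_or_exists_of_mem_SO3R hM⟩
end
end
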